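/- Let G be a connected graph of order n ≥ 4 with m edges. Then cDSO(G) ≤ (√5 − 2√2)n + (3√2 − √5)m, with equality if and only if G is the path P_n or the cycle C_n. -/

import Mathlib

open SimpleGraph Finset Real

noncomputable def HSO {V : Type*} [Fintype V] (G : SimpleGraph V) : ℝ :=
  letI := Classical.decRel G.Adj
  ∑ e ∈ G.edgeFinset, Sym2.lift
    ⟨fun x y => Real.sqrt ((G.degree x : ℝ) ^ 2 + (G.degree y : ℝ) ^ 2) /
      min (G.degree x : ℝ) (G.degree y : ℝ),
     fun x y => by simp [add_comm, min_comm]⟩ e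

noncomputable def SO {V : Type*} [Fintype V] (G : SimpleGraph V) : ℝ :=
  letI := Classical.decRel G.Adj
  ∑ e ∈ G.edgeFinset, Sym2.lift
    ⟨fun x y => Real.sqrt ((G.degree x : ℝ) ^ 2 + (G.degree y : ℝ) ^ 2),
     fun x y => by simp [add_comm]⟩ e

noncomputable def cDSO {V : Type*} [Fintype V] (G : SimpleGraph V) : ℝ :=
  letI := Classical.decRel G.Adj
  ∑ e ∈ G.edgeFinset, Sym2.lift
    ⟨fun x y => Real.sqrt ((G.degree x : ℝ) ^ 2 + (G.degree y : ℝ) ^ 2) /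
      max (G.degree x : ℝ) (G.degree y : ℝ),
     fun x y => by simp [add_comm, max_comm]⟩ e

noncomputable def M1 {V : Type*} [Fintype V] (G : SimpleGraph V) : ℝ :=
  letI := Classical.decRel G.Adj
  ∑ e ∈ G.edgeFinset, Sym2.lift
    ⟨fun x y => (G.degree x : ℝ) + (G.degree y : ℝ),
     fun x y => by simp [add_comm]⟩ e

def IsRegularGraph {V : Type*} [Fintype V] (G : SimpleGraph V) : Prop :=
  letI := Classical.decRel G.Adj
  ∃ k, G.IsRegularOfDegree k

def addEdge {V : Type*} (G : SimpleGraph V) (u v : V) : SimpleGraph V :=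
  G ⊔ SimpleGraph.fromEdgeSet {s(u, v)}

theorem sqrt_div_max_bound_of_le {a b : ℕ} (ha : 1 ≤ a) (hab : a ≤ b) (hb : 2 ≤ b) :
    √((a : ℝ) ^ 2 + (b : ℝ) ^ 2) / max (a : ℝ) (b : ℝ) ≤
        (√5 - 2 * √2) * (1 / a + 1 / b) + (3 * √2 - √5) ∧
      (√((a : ℝ) ^ 2 + (b : ℝ) ^ 2) / max (a : ℝ) (b : ℝ) =
        (√5 - 2 * √2) * (1 / a + 1 / b) + (3 * √2 - √5) ↔ b ≤ 2) := by
  have h5 : √5 < 2.23607 := (Real.sqrt_lt' (by norm_num)).2 (by norm_num)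
  have h5' : 2.23606 < √5 := Real.lt_sqrt_of_sq_lt (by norm_num)
  have h2 : √2 < 1.41422 := (Real.sqrt_lt' (by norm_num)).2 (by norm_num)
  have h2' : 1.41421 < √2 := Real.lt_sqrt_of_sq_lt (by norm_num)
  have hab' : (a : ℝ) ≤ b := by exact_mod_cast hab
  rw [max_eq_right hab']
  rcases hb.eq_or_lt with rfl | hb3
  · suffices √((a : ℝ) ^ 2 + ((2 : ℕ) : ℝ) ^ 2) / ((2 : ℕ) : ℝ) =
        (√5 - 2 * √2) * (1 / a + 1 / ((2 : ℕ) : ℝ)) + (3 * √2 - √5) from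
      ⟨this.le, fun _ => le_rfl, fun _ => this⟩
    interval_cases a
    · norm_num
      ring
    · have h8 : √8 = 2 * √2 := by
        rw [show (8 : ℝ) = 2 ^ 2 * 2 by norm_num, Real.sqrt_mul (by norm_num),
          Real.sqrt_sq (by norm_num)]
      norm_num [h8]
      ring
  · have hb3' : (3 : ℝ) ≤ b := by exact_mod_cast hb3
    have hb0 : (0 : ℝ) < b := by linarith
    have hbi : 1 / (b : ℝ) ≤ 1 / 3 := one_div_le_one_div_of_le (by norm_num) hb3'
    suffices √((a : ℝ) ^ 2 + (b : ℝ) ^ 2) / b <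
        (√5 - 2 * √2) * (1 / a + 1 / b) + (3 * √2 - √5) from
      ⟨this.le, fun h => absurd h this.ne, fun h => absurd h (by omega)⟩
    rcases ha.eq_or_lt with rfl | ha2
    · have h : √(((1 : ℕ) : ℝ) ^ 2 + (b : ℝ) ^ 2) / b ≤ 1.06 := by
        rw [div_le_iff₀ hb0]
        apply Real.sqrt_le_iff.2 ⟨by positivity, ?_⟩
        push_cast
        nlinarith
      push_cast at h ⊢
      nlinarith
    · have ha2' : (2 : ℝ) ≤ a := by exact_mod_cast ha2
      have hai : 1 / (a : ℝ) ≤ 1 / 2 := one_div_le_one_div_of_le (by norm_num) ha2'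
      have h : √((a : ℝ) ^ 2 + (b : ℝ) ^ 2) / b ≤ 1.42 := by
        rw [div_le_iff₀ hb0]
        apply Real.sqrt_le_iff.2 ⟨by positivity, ?_⟩
        nlinarith
      nlinarith

theorem sqrt_div_max_bound {a b : ℕ} (ha : 1 ≤ a) (hb : 1 ≤ b) (hab : ¬(a = 1 ∧ b = 1)) :
    √((a : ℝ) ^ 2 + (b : ℝ) ^ 2) / max (a : ℝ) (b : ℝ) ≤
        (√5 - 2 * √2) * (1 / a + 1 / b) + (3 * √2 - √5) ∧
      (√((a : ℝ) ^ 2 + (b : ℝ) ^ 2) / max (a : ℝ) (b : ℝ) =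
        (√5 - 2 * √2) * (1 / a + 1 / b) + (3 * √2 - √5) ↔ a ≤ 2 ∧ b ≤ 2) := by
  rcases le_total a b with h | h
  · have := sqrt_div_max_bound_of_le ha h (by omega)
    rwa [show (a ≤ 2 ∧ b ≤ 2) ↔ b ≤ 2 by omega]
  · have := sqrt_div_max_bound_of_le hb h (by omega)
    rwa [show (a ≤ 2 ∧ b ≤ 2) ↔ a ≤ 2 by omega, add_comm ((a : ℝ) ^ 2), max_comm,
      add_comm (1 / (a : ℝ))]

namespace SimpleGraph

section Sums

variable {V : Type*} [Fintype V] (G : SimpleGraph V) [DecidableRel G.Adj]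

/-- The sum over all edges of the reciprocal degrees of their ends counts the vertices. -/
theorem sum_edgeFinset_one_div_degree (hpos : ∀ v, 0 < G.degree v) :
    ∑ e ∈ G.edgeFinset, Sym2.lift ⟨fun x y => 1 / (G.degree x : ℝ) + 1 / (G.degree y : ℝ),
      fun _ _ => add_comm _ _⟩ e = Fintype.card V := by
  classical
  have hedge : ∀ e ∈ G.edgeFinset,
      Sym2.lift ⟨fun x y => 1 / (G.degree x : ℝ) + 1 / (G.degree y : ℝ),
        fun _ _ => add_comm _ _⟩ e = ∑ v, if v ∈ e then 1 / (G.degree v : ℝ) else 0 := by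
    intro e
    induction e using Sym2.ind with
    | _ x y =>
      intro he
      have hxy : x ≠ y := (G.mem_edgeSet.1 (mem_edgeFinset.1 he)).ne
      rw [← Finset.sum_filter, show ({v | v ∈ s(x, y)} : Finset V) = {x, y} by ext; simp,
        Finset.sum_pair hxy]
      rfl
  rw [Finset.sum_congr rfl hedge, Finset.sum_comm]
  have hvertex : ∀ v, ∑ e ∈ G.edgeFinset, (if v ∈ e then 1 / (G.degree v : ℝ) else 0) = 1 := by
    intro v
    rw [← Finset.sum_filter, ← incidenceFinset_eq_filter, Finset.sum_const,
      card_incidenceFinset_eq_degree, nsmul_eq_mul]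
    have := hpos v
    field_simp
  rw [Finset.sum_congr rfl fun v _ => hvertex v]
  simp

end Sums

section PathListing

variable {V : Type*} {G : SimpleGraph V}

/-- `f` lists the vertices of a path with `k` vertices. -/
def IsPathListing (G : SimpleGraph V) (k : ℕ) (f : ℕ → V) : Prop :=
  Set.InjOn f (Set.Iio k) ∧ ∀ i, i + 1 < k → G.Adj (f i) (f (i + 1))

theorem IsPathListing.le_card [Fintype V] {k : ℕ} {f : ℕ → V} (hf : G.IsPathListing k f) :
    k ≤ Fintype.card V := by
  classical
  have := Finset.card_le_univ ((Finset.range k).image f)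
  rwa [Finset.card_image_of_injOn (by simpa using hf.1), Finset.card_range] at this

theorem IsPathListing.snoc {k : ℕ} {f : ℕ → V} (hf : G.IsPathListing (k + 1) f) {w : V}
    (hw : ∀ i < k + 1, f i ≠ w) (hadj : G.Adj (f k) w) :
    G.IsPathListing (k + 2) fun i => if i < k + 1 then f i else w := by
  refine ⟨fun i hi j hj hij => ?_, fun i hi => ?_⟩
  · simp only [Set.mem_Iio] at hi hj
    dsimp only at hij
    split_ifs at hij with h1 h2 h2
    · exact hf.1 h1 h2 hij
    · exact absurd hij (hw i h1)
    · exact absurd hij.symm (hw j h2)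
    · omega
  · dsimp only
    rcases (show i ≤ k by omega).eq_or_lt with rfl | h
    · simpa using hadj
    · rw [if_pos (by omega), if_pos (by omega)]
      exact hf.2 i (by omega)

theorem IsPathListing.cons {k : ℕ} {f : ℕ → V} (hf : G.IsPathListing k f) {w : V}
    (hw : ∀ i < k, f i ≠ w) (hadj : G.Adj w (f 0)) :
    G.IsPathListing (k + 1) fun i => Nat.casesOn i w f := by
  refine ⟨fun i hi j hj hij => ?_, fun i hi => ?_⟩
  · simp only [Set.mem_Iio] at hi hj
    rcases i with _ | i <;> rcases j with _ | j
    · rfl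
    · exact absurd hij.symm (hw j (by omega))
    · exact absurd hij (hw i (by omega))
    · exact congrArg _ (hf.1 (show i < k by omega) (show j < k by omega) hij)
  · rcases i with _ | i
    · exact hadj
    · exact hf.2 i (by omega)

end PathListing

section DegreeAtMostTwo

variable {V : Type*} [Fintype V] {G : SimpleGraph V} [DecidableRel G.Adj]

theorem eq_or_eq_or_eq_of_degree_le_two {x a b c : V} (hx : G.degree x ≤ 2) (ha : G.Adj x a)
    (hb : G.Adj x b) (hc : G.Adj x c) : a = b ∨ a = c ∨ b = c := by
  classical
  by_contra! h
  have hsub : ({a, b, c} : Finset V) ⊆ G.neighborFinset x := by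
    intro z
    simp only [Finset.mem_insert, Finset.mem_singleton, mem_neighborFinset]
    rintro (rfl | rfl | rfl) <;> assumption
  have := Finset.card_le_card hsub
  rw [Finset.card_eq_three.2 ⟨a, b, c, h.1, h.2.1, h.2.2, rfl⟩, card_neighborFinset_eq_degree]
    at this
  omega

theorem degree_ne_one_of_adj_of_degree_eq_one (hconn : G.Connected) (hV : 3 ≤ Fintype.card V)
    {u v : V} (huv : G.Adj u v) (hu : G.degree u = 1) : G.degree v ≠ 1 := by
  classical
  intro hv
  have hclosed : ∀ x y, G.Adj x y → (x = u ∨ x = v) → (y = u ∨ y = v) := by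
    rintro x y hxy (rfl | rfl)
    · obtain ⟨z, -, hz⟩ := degree_eq_one_iff_existsUnique_adj.1 hu
      exact .inr ((hz y hxy).trans (hz v huv).symm)
    · obtain ⟨z, -, hz⟩ := degree_eq_one_iff_existsUnique_adj.1 hv
      exact .inl ((hz y hxy).trans (hz u huv.symm).symm)
  have hall : ∀ w, w = u ∨ w = v := by
    intro w
    obtain ⟨p⟩ := hconn.preconnected u w
    have : ∀ {x w : V}, G.Walk x w → (x = u ∨ x = v) → (w = u ∨ w = v) := by
      intro x w p
      induction p with
      | nil => exact id
      | cons h _ ih => exact fun hx => ih (hclosed _ _ h hx)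
    exact this p (.inl rfl)
  have hsub : (Finset.univ : Finset V) ⊆ {u, v} := fun w _ => by simpa using hall w
  have := (Finset.card_le_card hsub).trans Finset.card_le_two
  rw [Finset.card_univ] at this
  omega

/-- A connected graph with maximum degree at most two has a Hamiltonian path. -/
theorem exists_isPathListing_card (hconn : G.Connected) (hdeg : ∀ v, G.degree v ≤ 2) :
    ∃ f, G.IsPathListing (Fintype.card V) f ∧ ∀ v, ∃ i < Fintype.card V, f i = v := by
  classical
  obtain ⟨v₀⟩ := hconn.nonempty
  let P : ℕ → Prop := fun k => ∃ f, G.IsPathListing (k + 1) f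
  have hP0 : P 0 := ⟨fun _ => v₀, fun i hi j hj _ => by simp at hi hj; omega,
    fun i hi => by omega⟩
  obtain ⟨k, ⟨f, hf⟩, hmax⟩ : ∃ k, P k ∧ ∀ l, P l → l ≤ k :=
    ⟨Nat.findGreatest P (Fintype.card V), Nat.findGreatest_spec (Nat.zero_le _) hP0,
      fun l hl => Nat.le_findGreatest (by obtain ⟨f, hf⟩ := hl; have := hf.le_card; omega) hl⟩
  have hstep : ∀ x y, G.Adj x y → (∃ i < k + 1, f i = x) → ∃ i < k + 1, f i = y := by
    rintro _ w hxw ⟨i, hi, rfl⟩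
    by_contra! hw
    rcases (show i ≤ k by omega).eq_or_lt with rfl | hik
    · have := hmax (i + 1) ⟨_, hf.snoc hw hxw⟩
      omega
    rcases i with _ | i
    · have := hmax (k + 1) ⟨_, hf.cons hw hxw.symm⟩
      omega
    · rcases eq_or_eq_or_eq_of_degree_le_two (hdeg _) (hf.2 i (by omega)).symm
        (hf.2 (i + 1) (by omega)) hxw with h | h | h
      · have := hf.1 (show i < k + 1 by omega) (show i + 1 + 1 < k + 1 by omega) h
        omega
      · exact hw _ (by omega) h
      · exact hw _ (by omega) h
  have hall : ∀ w, ∃ i < k + 1, f i = w := by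
    intro w
    obtain ⟨p⟩ := hconn.preconnected (f 0) w
    have : ∀ {x w : V}, G.Walk x w → (∃ i < k + 1, f i = x) → ∃ i < k + 1, f i = w := by
      intro x w p
      induction p with
      | nil => exact id
      | cons h _ ih => exact fun hx => ih (hstep _ _ h hx)
    exact this p ⟨0, by omega, rfl⟩
  have hcard : Fintype.card V = k + 1 := by
    refine le_antisymm ?_ hf.le_card
    have hsub : (Finset.univ : Finset V) ⊆ (Finset.range (k + 1)).image f := fun w _ => by
      obtain ⟨i, hi, h⟩ := hall w
      exact Finset.mem_image.2 ⟨i, Finset.mem_range.2 hi, h⟩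
    simpa using (Finset.card_le_card hsub).trans Finset.card_image_le
  rw [hcard]
  exact ⟨f, hf, hall⟩

/-- A chord of a Hamiltonian path can only join its two ends. -/
theorem IsPathListing.adj_of_lt {k : ℕ} {f : ℕ → V} (hf : G.IsPathListing k f)
    (hdeg : ∀ v, G.degree v ≤ 2) {i j : ℕ} (hij : i < j) (hj : j < k) (h : G.Adj (f i) (f j)) :
    i + 1 = j ∨ i = 0 ∧ j + 1 = k := by
  by_contra! hne
  rcases i with _ | i
  · obtain ⟨j, rfl⟩ : ∃ l, j = l + 1 := ⟨j - 1, by omega⟩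
    have hjk : j + 1 + 1 ≠ k := hne.2 rfl
    rcases eq_or_eq_or_eq_of_degree_le_two (hdeg _) (hf.2 j (by omega)).symm
      (hf.2 (j + 1) (by omega)) h.symm with e | e | e
    all_goals
      have := hf.1 (show _ < k by omega) (show _ < k by omega) e
      omega
  · rcases eq_or_eq_or_eq_of_degree_le_two (hdeg _) (hf.2 i (by omega)).symm
      (hf.2 (i + 1) (by omega)) h with e | e | e
    all_goals
      have := hf.1 (show _ < k by omega) (show _ < k by omega) e
      omega

theorem cycleGraph_adj_iff_val {n : ℕ} (hn : 3 ≤ n) (i j : Fin n) :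
    (cycleGraph n).Adj i j ↔ i.val + 1 = j.val ∨ j.val + 1 = i.val ∨
      i.val = 0 ∧ j.val + 1 = n ∨ j.val = 0 ∧ i.val + 1 = n := by
  rw [cycleGraph_adj']
  have hi := i.isLt
  have hj := j.isLt
  have hsub : ∀ a b : Fin n, (a - b).val = if b.val ≤ a.val then a.val - b.val
      else n + a.val - b.val := by
    intro a b
    split_ifs with h
    · exact Fin.sub_val_of_le h
    · exact Fin.coe_sub_iff_lt.2 (by simpa using h)
  rw [hsub, hsub]
  split_ifs <;> omega

theorem nonempty_iso_pathGraph_or_cycleGraph (hconn : G.Connected)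
    (hdeg : ∀ v, G.degree v ≤ 2) (hV : 3 ≤ Fintype.card V) :
    Nonempty (G ≃g pathGraph (Fintype.card V)) ∨
      Nonempty (G ≃g cycleGraph (Fintype.card V)) := by
  obtain ⟨f, hf, hsurj⟩ := exists_isPathListing_card hconn hdeg
  generalize Fintype.card V = n at *
  let φ : Fin n ≃ V := Equiv.ofBijective (fun i => f i)
    ⟨fun i j h => Fin.ext (hf.1 i.isLt j.isLt h),
      fun v => by obtain ⟨i, hi, h⟩ := hsurj v; exact ⟨⟨i, hi⟩, h⟩⟩
  have hforward : ∀ i j : Fin n, G.Adj (φ i) (φ j) → i.val + 1 = j.val ∨ j.val + 1 = i.val ∨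
      i.val = 0 ∧ j.val + 1 = n ∨ j.val = 0 ∧ i.val + 1 = n := by
    intro i j h
    rcases lt_trichotomy i.val j.val with hij | hij | hij
    · have := hf.adj_of_lt hdeg hij j.isLt h
      omega
    · exact absurd (congrArg φ (Fin.ext hij)) h.ne
    · have := hf.adj_of_lt hdeg hij i.isLt h.symm
      omega
  have hsucc : ∀ i j : Fin n, i.val + 1 = j.val → G.Adj (φ i) (φ j) := by
    intro i j h
    have := hf.2 i.val (by omega)
    rwa [h] at this
  by_cases hend : G.Adj (f 0) (f (n - 1))
  · have hwrap : ∀ i j : Fin n, i.val = 0 → j.val + 1 = n → G.Adj (φ i) (φ j) := by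
      intro i j hi hj
      rw [← hi, show n - 1 = j.val by omega] at hend
      exact hend
    refine .inr ⟨RelIso.symm ⟨φ, fun {i j} => ?_⟩⟩
    rw [cycleGraph_adj_iff_val hV]
    refine ⟨hforward i j, ?_⟩
    rintro (h | h | ⟨h, h'⟩ | ⟨h, h'⟩)
    · exact hsucc _ _ h
    · exact (hsucc _ _ h).symm
    · exact hwrap _ _ h h'
    · exact (hwrap _ _ h h').symm
  · have hwrap : ∀ i j : Fin n, i.val = 0 → j.val + 1 = n → ¬ G.Adj (φ i) (φ j) := by
      intro i j hi hj h
      rw [← hi, show n - 1 = j.val by omega] at hend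
      exact hend h
    refine .inl ⟨RelIso.symm ⟨φ, fun {i j} => ?_⟩⟩
    rw [pathGraph_adj]
    constructor
    · intro h
      rcases hforward i j h with h' | h' | ⟨h', h''⟩ | ⟨h', h''⟩
      · exact .inl h'
      · exact .inr h'
      · exact absurd h (hwrap _ _ h' h'')
      · exact absurd h.symm (hwrap _ _ h' h'')
    · rintro (h | h)
      · exact hsucc _ _ h
      · exact (hsucc _ _ h).symm

theorem degree_le_two_of_iso_pathGraph {n : ℕ} (φ : G ≃g pathGraph n) (v : V) :
    G.degree v ≤ 2 := by
  classical
  by_contra! h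
  rw [← card_neighborFinset_eq_degree] at h
  obtain ⟨a, b, c, ha, hb, hc, hab, hac, hbc⟩ := Finset.two_lt_card_iff.1 h
  simp only [mem_neighborFinset, ← φ.map_adj_iff, pathGraph_adj] at ha hb hc
  have inj : ∀ {x y : V}, x ≠ y → (φ x).val ≠ (φ y).val :=
    fun hxy h => hxy (φ.injective (Fin.ext h))
  have := inj hab
  have := inj hac
  have := inj hbc
  omega

theorem degree_le_two_of_iso_cycleGraph {n : ℕ} (hn : 3 ≤ n) (φ : G ≃g cycleGraph n) (v : V) :
    G.degree v ≤ 2 := by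
  classical
  by_contra! h
  rw [← card_neighborFinset_eq_degree] at h
  obtain ⟨a, b, c, ha, hb, hc, hab, hac, hbc⟩ := Finset.two_lt_card_iff.1 h
  simp only [mem_neighborFinset, ← φ.map_adj_iff, cycleGraph_adj_iff_val hn] at ha hb hc
  have inj : ∀ {x y : V}, x ≠ y → (φ x).val ≠ (φ y).val :=
    fun hxy h => hxy (φ.injective (Fin.ext h))
  have := inj hab
  have := inj hac
  have := inj hbc
  omega

end DegreeAtMostTwo

end SimpleGraph

theorem cDSO_eq_sum {V : Type*} [Fintype V] (G : SimpleGraph V) [DecidableRel G.Adj] :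
    cDSO G = ∑ e ∈ G.edgeFinset, Sym2.lift
      ⟨fun x y => √((G.degree x : ℝ) ^ 2 + (G.degree y : ℝ) ^ 2) /
        max (G.degree x : ℝ) (G.degree y : ℝ),
      fun x y => by simp [add_comm, max_comm]⟩ e := by
  obtain rfl := Subsingleton.elim ‹DecidableRel G.Adj› (Classical.decRel G.Adj)
  rfl

theorem stmt18 {V : Type*} [Fintype V] (G : SimpleGraph V) [DecidableRel G.Adj]
    (n m : ℕ) (hn : n = Fintype.card V) (hm : m = G.edgeFinset.card)
    (hn4 : 4 ≤ n) (hconn : G.Connected) :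
    cDSO G ≤ (Real.sqrt 5 - 2 * Real.sqrt 2) * n + (3 * Real.sqrt 2 - Real.sqrt 5) * m ∧
    (cDSO G = (Real.sqrt 5 - 2 * Real.sqrt 2) * n + (3 * Real.sqrt 2 - Real.sqrt 5) * m ↔
      Nonempty (G ≃g pathGraph n) ∨ Nonempty (G ≃g cycleGraph n)) := by
  subst hn hm
  have : Nontrivial V := Fintype.one_lt_card_iff_nontrivial.1 (by omega)
  have hpos : ∀ v, 0 < G.degree v := fun v => hconn.preconnected.degree_pos_of_nontrivial v
  have hbound {x y : V} (h : G.Adj x y) := sqrt_div_max_bound (hpos x) (hpos y)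
    fun h1 => G.degree_ne_one_of_adj_of_degree_eq_one hconn (by omega) h h1.1 h1.2
  rw [← G.sum_edgeFinset_one_div_degree hpos, mul_comm _ (G.edgeFinset.card : ℝ), ← nsmul_eq_mul,
    ← Finset.sum_const, Finset.mul_sum, ← Finset.sum_add_distrib, cDSO_eq_sum]
  have hle : ∀ e ∈ G.edgeFinset, Sym2.lift
      ⟨fun x y => √((G.degree x : ℝ) ^ 2 + (G.degree y : ℝ) ^ 2) /
        max (G.degree x : ℝ) (G.degree y : ℝ),
      fun x y => by simp [add_comm, max_comm]⟩ e ≤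
      (√5 - 2 * √2) * Sym2.lift ⟨fun x y => 1 / (G.degree x : ℝ) + 1 / (G.degree y : ℝ),
        fun _ _ => add_comm _ _⟩ e + (3 * √2 - √5) := by
    intro e
    induction e using Sym2.ind with
    | _ x y => exact fun he => (hbound (G.mem_edgeSet.1 (mem_edgeFinset.1 he))).1
  refine ⟨Finset.sum_le_sum hle, ?_⟩
  rw [Finset.sum_eq_sum_iff_of_le hle]
  constructor
  · intro heq
    refine nonempty_iso_pathGraph_or_cycleGraph hconn (fun v => ?_) (by omega)
    obtain ⟨w, hw⟩ := (G.degree_pos_iff_exists_adj v).1 (hpos v)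
    exact ((hbound hw).2.1 (heq s(v, w) (mem_edgeFinset.2 hw))).1
  · intro hiso
    have hdeg : ∀ v, G.degree v ≤ 2 := by
      rcases hiso with ⟨⟨φ⟩⟩ | ⟨⟨φ⟩⟩
      · exact degree_le_two_of_iso_pathGraph φ
      · exact degree_le_two_of_iso_cycleGraph (by omega) φ
    intro e
    induction e using Sym2.ind with
    | _ x y =>
      exact fun he => (hbound (G.mem_edgeSet.1 (mem_edgeFinset.1 he))).2.2 ⟨hdeg x, hdeg y⟩
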